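/- arXiv:2605.05659 — 2 statements merged into one kernel-verified Lean document; each statement's English description precedes it below -/
import Mathlib

section
/- Let x_1, ..., x_M ∈ ℝ^d be pairwise distinct inputs and Z ∈ ℝ^{k×M} an arbitrary target matrix with columns z_1, ..., z_M. Let σ : ℝ → ℝ be a continuous, non-mean-periodic function. Then there exist parameters u_1 ∈ ℝ^M, v_1 ∈ ℝ^d, b_1 ∈ ℝ^M, a full outer weight matrix W_2 ∈ ℝ^{k×M}, and a bias b_2 ∈ ℝ^k such that W_2 σ(u_1 (v_1·x_i) + b_1) + b_2 = z_i for all i ∈ {1, ..., M}; that is, a network with a strictly rank-1 hidden weight matrix but a fully parameterized outer layer achieves exactly zero interpolation error on arbitrary multi-dimensional targets. -/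
open MeasureTheory

/-- The integral of a real function against a signed measure, via its Jordan
decomposition. -/
noncomputable def signedIntegral (s : SignedMeasure ℝ) (f : ℝ → ℝ) : ℝ :=
  (∫ t, f t ∂s.toJordanDecomposition.posPart) - ∫ t, f t ∂s.toJordanDecomposition.negPart

/-- A continuous function `σ : ℝ → ℝ` is mean-periodic if there is a nonzero
compactly supported signed Borel measure `μ` with `∫ σ (x - t) dμ(t) = 0` for all
`x`. -/
def MeanPeriodic (σ : ℝ → ℝ) : Prop :=
  ∃ s : SignedMeasure ℝ, s ≠ 0 ∧
    (∃ Kc : Set ℝ, IsCompact Kc ∧ ∀ A : Set ℝ, MeasurableSet A → Disjoint A Kc → s A = 0) ∧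
    ∀ x : ℝ, signedIntegral s (fun t => σ (x - t)) = 0

/-- The positive part `∑ i, (c i)⁺ δ_{p i}` of a finite combination of Dirac measures. -/
noncomputable def diracSum {ι : Type*} [Fintype ι] (p : ι → ℝ) (c : ι → ℝ) : Measure ℝ :=
  ∑ i, (c i).toNNReal • Measure.dirac (p i)

instance {ι : Type*} [Fintype ι] (p : ι → ℝ) (c : ι → ℝ) : IsFiniteMeasure (diracSum p c) := by
  unfold diracSum; infer_instance

theorem diracSum_apply {ι : Type*} [Fintype ι] (p c : ι → ℝ) (A : Set ℝ) :
    diracSum p c A = ∑ i, ((c i).toNNReal : ENNReal) * A.indicator 1 (p i) := by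
  rw [diracSum, Measure.finsetSum_apply]
  refine Finset.sum_congr rfl fun i _ => ?_
  rw [Measure.smul_apply, Measure.dirac_apply, ENNReal.smul_def, smul_eq_mul]

theorem diracSum_real_apply {ι : Type*} [Fintype ι] (p c : ι → ℝ) (A : Set ℝ) :
    (diracSum p c).real A = ∑ i, max (c i) 0 * A.indicator 1 (p i) := by
  rw [measureReal_def, diracSum_apply, ENNReal.toReal_sum]
  · refine Finset.sum_congr rfl fun i _ => ?_
    by_cases h : p i ∈ A <;> simp [h]
  · intro i _
    by_cases h : p i ∈ A <;> simp [h]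

theorem integral_diracSum {ι : Type*} [Fintype ι] (p c : ι → ℝ) (f : ℝ → ℝ) :
    ∫ t, f t ∂(diracSum p c) = ∑ i, max (c i) 0 * f (p i) := by
  rw [diracSum, integral_finsetSum_measure]
  · simp [integral_smul_nnreal_measure, NNReal.smul_def]
  · intro i _
    exact (integrable_dirac (by simp)).smul_measure_nnreal

theorem diracSum_mutuallySingular {ι : Type*} [Fintype ι] {p : ι → ℝ}
    (hp : Function.Injective p) (c : ι → ℝ) :
    diracSum p c ⟂ₘ diracSum p (-c) := by
  refine ⟨p '' {i | c i ≤ 0}, (Set.toFinite _).measurableSet, ?_, ?_⟩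
  · rw [diracSum_apply]
    refine Finset.sum_eq_zero fun i _ => ?_
    by_cases h : c i ≤ 0 <;> simp [h, hp.mem_set_image]
  · rw [diracSum_apply]
    refine Finset.sum_eq_zero fun i _ => ?_
    by_cases h : c i ≤ 0
    · simp [h, hp.mem_set_image]
    · simp [(not_le.1 h).le]

/-- The Jordan decomposition of `∑ i, c i δ_{p i}` for distinct points `p i`. -/
noncomputable def diracJordan {ι : Type*} [Fintype ι] {p : ι → ℝ}
    (hp : Function.Injective p) (c : ι → ℝ) : JordanDecomposition ℝ where
  posPart := diracSum p c
  negPart := diracSum p (-c)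
  mutuallySingular := diracSum_mutuallySingular hp c

theorem max_zero_sub_max_neg_zero_mul (a b : ℝ) : max a 0 * b - max (-a) 0 * b = a * b := by
  rw [← sub_mul, max_zero_sub_max_neg_zero_eq_self]

theorem diracJordan_toSignedMeasure_apply {ι : Type*} [Fintype ι] {p : ι → ℝ}
    (hp : Function.Injective p) (c : ι → ℝ) {A : Set ℝ} (hA : MeasurableSet A) :
    (diracJordan hp c).toSignedMeasure A = ∑ i, c i * A.indicator 1 (p i) := by
  rw [JordanDecomposition.toSignedMeasure, Measure.toSignedMeasure_sub_apply hA]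
  simp only [diracJordan, diracSum_real_apply, ← Finset.sum_sub_distrib, Pi.neg_apply,
    max_zero_sub_max_neg_zero_mul]

theorem signedIntegral_diracJordan {ι : Type*} [Fintype ι] {p : ι → ℝ}
    (hp : Function.Injective p) (c : ι → ℝ) (f : ℝ → ℝ) :
    signedIntegral (diracJordan hp c).toSignedMeasure f = ∑ i, c i * f (p i) := by
  rw [signedIntegral, JordanDecomposition.toJordanDecomposition_toSignedMeasure]
  simp only [diracJordan, integral_diracSum, ← Finset.sum_sub_distrib, Pi.neg_apply,
    max_zero_sub_max_neg_zero_mul]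

/-- A nontrivial linear relation between finitely many translates forces mean-periodicity. -/
theorem MeanPeriodic.of_sum_translates_eq_zero {ι : Type*} [Fintype ι] {σ : ℝ → ℝ} {t : ι → ℝ}
    (ht : Function.Injective t) {c : ι → ℝ} (hc : c ≠ 0)
    (h : ∀ b, ∑ i, c i * σ (t i + b) = 0) : MeanPeriodic σ := by
  have hp : Function.Injective fun i => -t i := neg_injective.comp ht
  refine ⟨(diracJordan hp c).toSignedMeasure, fun h0 => hc ?_,
    ⟨Set.range fun i => -t i, (Set.finite_range _).isCompact, fun A hA hd => ?_⟩, fun x => ?_⟩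
  · ext i
    have h1 := diracJordan_toSignedMeasure_apply hp c (measurableSet_singleton (-t i))
    rw [h0, Finset.sum_eq_single i] at h1
    · simpa using h1.symm
    · intro j _ hj
      simp [ht.ne hj]
    · simp
  · rw [diracJordan_toSignedMeasure_apply hp c hA]
    refine Finset.sum_eq_zero fun i _ => ?_
    have : -t i ∉ A := fun hi => Set.disjoint_left.1 hd hi ⟨i, rfl⟩
    simp [this]
  · rw [signedIntegral_diracJordan, ← h x]
    exact Finset.sum_congr rfl fun i _ => by rw [sub_neg_eq_add, add_comm]

/-- Some linear functional separates finitely many distinct points. -/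
theorem exists_injective_dotProduct {ι κ : Type*} [Finite ι] [Fintype κ] {x : ι → κ → ℝ}
    (hx : Function.Injective x) :
    ∃ v : κ → ℝ, Function.Injective fun i => ∑ a, v a * x i a := by
  classical
  obtain ⟨f, hf⟩ := Module.exists_dual_forall_apply_ne_zero (K := ℝ)
    (fun q : {q : ι × ι // q.1 ≠ q.2} => x q.1.1 - x q.1.2)
    (fun q => sub_ne_zero.2 (hx.ne q.2))
  refine ⟨fun a => f (Pi.single a 1), fun i j hij => ?_⟩
  by_contra hne
  have key (y : κ → ℝ) : f y = ∑ a, f (Pi.single a 1) * y a := by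
    conv_lhs => rw [pi_eq_sum_univ' y]
    simp [mul_comm]
  refine hf ⟨(i, j), hne⟩ ?_
  rw [map_sub, key (x i), key (x j), sub_eq_zero]
  exact hij

/-- If no nonzero linear form vanishes on a family of vectors of `ℝ^M`, then `M` of them
span. -/
theorem exists_span_eq_top_of_forall_sum_ne_zero {M : ℕ} {β : Type*} (f : β → Fin M → ℝ)
    (hf : ∀ c : Fin M → ℝ, (∀ b, ∑ i, c i * f b i = 0) → c = 0) :
    ∃ b : Fin M → β, Submodule.span ℝ (Set.range fun j => f (b j)) = ⊤ := by
  have htop : Submodule.span ℝ (Set.range f) = ⊤ := by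
    by_contra hne
    obtain ⟨g, hg0, hg⟩ := Submodule.exists_le_ker_of_lt_top _ (lt_top_iff_ne_top.2 hne)
    have key (y : Fin M → ℝ) : g y = ∑ a, g (Pi.single a 1) * y a := by
      conv_lhs => rw [pi_eq_sum_univ' y]
      simp [mul_comm]
    have hc := hf (fun a => g (Pi.single a 1)) fun b => by
      rw [← key]
      exact hg (Submodule.subset_span ⟨b, rfl⟩)
    refine hg0 (LinearMap.ext fun y => ?_)
    rw [key y]
    exact Finset.sum_eq_zero fun a _ => by
      rw [show g (Pi.single a 1) = 0 from congrFun hc a, zero_mul]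
  obtain ⟨g, hg, hspan, -⟩ := Submodule.exists_fun_fin_finrank_span_eq ℝ (Set.range f)
  have hM : Module.finrank ℝ (Submodule.span ℝ (Set.range f)) = M := by
    rw [htop, finrank_top, Module.finrank_fin_fun]
  choose b hb using hg
  refine ⟨b ∘ finCongr hM.symm, ?_⟩
  have hr : (fun j => f ((b ∘ finCongr hM.symm) j)) = g ∘ finCongr hM.symm :=
    funext fun j => hb _
  rw [hr, (finCongr hM.symm).surjective.range_comp, hspan]
  exact htop

/-- Zero-error memorization with rank-1 hidden layer and full outer
layer: for pairwise distinct inputs `x i ∈ ℝ^d`, arbitrary multi-dimensional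
targets `z i ∈ ℝ^k`, and a continuous non-mean-periodic activation `σ`, there exist
`u₁ ∈ ℝ^M, v₁ ∈ ℝ^d, b₁ ∈ ℝ^M`, a full outer weight matrix `W₂ ∈ ℝ^{k×M}` and bias
`b₂ ∈ ℝ^k` with `W₂ σ(u₁ (v₁ ⬝ x i) + b₁) + b₂ = z i` for all `i`. -/
theorem stmt6 (d M k : ℕ) (x : Fin M → Fin d → ℝ) (hx : Function.Injective x)
    (z : Fin M → Fin k → ℝ) (σ : ℝ → ℝ) (hσc : Continuous σ) (hσ : ¬ MeanPeriodic σ) :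
    ∃ (u1 : Fin M → ℝ) (v1 : Fin d → ℝ) (b1 : Fin M → ℝ)
      (W2 : Matrix (Fin k) (Fin M) ℝ) (b2 : Fin k → ℝ),
      ∀ i, W2.mulVec (fun j => σ (u1 j * (∑ a, v1 a * x i a) + b1 j)) + b2 = z i := by
  obtain ⟨v, hv⟩ := exists_injective_dotProduct hx
  obtain ⟨b, hb⟩ := exists_span_eq_top_of_forall_sum_ne_zero
    (fun (b : ℝ) (i : Fin M) => σ ((∑ a, v a * x i a) + b)) fun c hc => by
      by_contra hc0
      exact hσ (MeanPeriodic.of_sum_translates_eq_zero hv hc0 hc)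
  have hw (r : Fin k) : ∃ w : Fin M → ℝ,
      ∑ j, w j • (fun i => σ ((∑ a, v a * x i a) + b j)) = fun i => z i r :=
    (Submodule.mem_span_range_iff_exists_fun ℝ).1 (hb ▸ Submodule.mem_top)
  choose W hW using hw
  refine ⟨1, v, b, W, 0, fun i => ?_⟩
  ext r
  simpa [Matrix.mulVec, dotProduct] using congrFun (hW r) i
end

section
/- Let ρ : ℝ → ℝ be a non-affine continuous function that is differentiable at some point c ∈ ℝ with ρ'(c) ≠ 0, applied componentwise. Let K ⊂ ℝ^n be compact. Then the class of deep DLoR neural networks of arbitrary depth and width bounded by 2(n + m + 2), in which every hidden weight matrix has the form α I + u vᵀ, is dense in C(K, ℝ^m) with respect to the uniform norm: for every continuous f : K → ℝ^m and every ε > 0 there exists such a network f̂ with sup_{x ∈ K} ‖f̂(x) − f(x)‖ < ε. The construction operates in an augmented state space of width 2N (N = n + m + 2), preserving the input in one block while accumulating rank-1 updates in the other. -/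
/-- Zero-padding of a vector in `ℝ^n` into `ℝ^N`. -/
def padInput (n N : ℕ) (x : Fin n → ℝ) : Fin N → ℝ :=
  fun j => if h : (j : ℕ) < n then x ⟨j, h⟩ else 0

/-- Forward pass of a deep DLoR network on `ℝ^N`: each layer is described by data
`(α, u, v, b)` and computes `z ↦ ρ((α I + u vᵀ) z + b)` with `ρ` applied
componentwise. -/
noncomputable def dlorForward (ρ : ℝ → ℝ) {N : ℕ}
    (layers : List (ℝ × (Fin N → ℝ) × (Fin N → ℝ) × (Fin N → ℝ))) (z : Fin N → ℝ) :
    Fin N → ℝ :=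
  layers.foldl
    (fun s p => fun i =>
      ρ (((p.1 • (1 : Matrix (Fin N) (Fin N) ℝ) +
            Matrix.vecMulVec p.2.1 p.2.2.1).mulVec s) i + p.2.2.2 i))
    z

theorem ContinuousMap.curry_zero_mem_of_isClosed {X Y : Type*} [TopologicalSpace X]
    [TopologicalSpace Y] {S : Set C(X, Y)} (hS : IsClosed S) (F : C(ℝ × X, Y))
    (h : ∀ t : ℝ, t ≠ 0 → F.curry t ∈ S) : F.curry 0 ∈ S := by
  have hd : Dense ({0}ᶜ : Set ℝ) := dense_compl_singleton 0
  have hc : IsClosed (F.curry ⁻¹' S) := hS.preimage F.curry.continuous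
  exact hc.closure_subset_iff.2 (fun t ht => h t ht) (hd 0)

section Machine

variable {N : ℕ}

theorem dlorForward_concat (ρ : ℝ → ℝ)
    (layers : List (ℝ × (Fin N → ℝ) × (Fin N → ℝ) × (Fin N → ℝ)))
    (α : ℝ) (u v b z : Fin N → ℝ) (i : Fin N) :
    dlorForward ρ (layers ++ [(α, u, v, b)]) z i =
      ρ (α * dlorForward ρ layers z i + u i * (v ⬝ᵥ dlorForward ρ layers z) + b i) := by
  simp [dlorForward, List.foldl_append, Matrix.add_mulVec, Matrix.smul_mulVec,
    Matrix.vecMulVec_mulVec, mul_comm]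

/-- The affine map `z ↦ (α I + u vᵀ) z + b`. -/
def dlorAffine (α : ℝ) (u v b : Fin N → ℝ) : C(Fin N → ℝ, Fin N → ℝ) where
  toFun z i := α * z i + u i * (v ⬝ᵥ z) + b i
  continuous_toFun := by unfold dotProduct; fun_prop

@[simp]
theorem dlorAffine_apply (α : ℝ) (u v b z : Fin N → ℝ) (i : Fin N) :
    dlorAffine α u v b z i = α * z i + u i * (v ⬝ᵥ z) + b i := rfl

/-- The layer `z ↦ ρ((α I + u vᵀ) z + b)`. -/
def dlorLayer (ρ : C(ℝ, ℝ)) (α : ℝ) (u v b : Fin N → ℝ) : C(Fin N → ℝ, Fin N → ℝ) where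
  toFun z i := ρ (dlorAffine α u v b z i)
  continuous_toFun := by fun_prop

@[simp]
theorem dlorLayer_apply (ρ : C(ℝ, ℝ)) (α : ℝ) (u v b z : Fin N → ℝ) (i : Fin N) :
    dlorLayer ρ α u v b z i = ρ (α * z i + u i * (v ⬝ᵥ z) + b i) := rfl

/-- The instruction overwriting coordinate `j` with the value of `g`. -/
def assign (j : Fin N) (g : C(Fin N → ℝ, ℝ)) : C(Fin N → ℝ, Fin N → ℝ) where
  toFun z := Function.update z j (g z)
  continuous_toFun := continuous_id.update j g.continuous

@[simp]
theorem assign_apply (j : Fin N) (g : C(Fin N → ℝ, ℝ)) (z : Fin N → ℝ) :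
    assign j g z = Function.update z j (g z) := rfl

/-- The affine functional `z ↦ v ⬝ᵥ z + b`. -/
def affineForm (v : Fin N → ℝ) (b : ℝ) : C(Fin N → ℝ, ℝ) where
  toFun z := v ⬝ᵥ z + b
  continuous_toFun := by unfold dotProduct; fun_prop

@[simp]
theorem affineForm_apply (v : Fin N → ℝ) (b : ℝ) (z : Fin N → ℝ) :
    affineForm v b z = v ⬝ᵥ z + b := rfl

/-- Networks followed by a homothety. -/
def realizable (ρ : C(ℝ, ℝ)) (N : ℕ) : Set C(Fin N → ℝ, Fin N → ℝ) :=
  {Φ | ∃ layers a, ∃ t : Fin N → ℝ, ∀ z i, Φ z i = a * dlorForward ρ layers z i + t i}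

/-- Continuous maps preserving approximability by realizable maps under postcomposition. -/
def preserving (ρ : C(ℝ, ℝ)) (N : ℕ) : Set C(Fin N → ℝ, Fin N → ℝ) :=
  {Ψ | ∀ Φ ∈ closure (realizable ρ N), Ψ.comp Φ ∈ closure (realizable ρ N)}

variable {ρ : C(ℝ, ℝ)}

theorem isClosed_preserving : IsClosed (preserving ρ N) := by
  have : preserving ρ N = ⋂ Φ ∈ closure (realizable ρ N),
      (fun Ψ : C(Fin N → ℝ, Fin N → ℝ) => Ψ.comp Φ) ⁻¹' closure (realizable ρ N) := by
    ext Ψ; simp [preserving]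
  rw [this]
  exact isClosed_biInter fun Φ _ => isClosed_closure.preimage Φ.continuous_precomp

theorem comp_mem_preserving {Ψ₁ Ψ₂ : C(Fin N → ℝ, Fin N → ℝ)} (h₁ : Ψ₁ ∈ preserving ρ N)
    (h₂ : Ψ₂ ∈ preserving ρ N) : Ψ₁.comp Ψ₂ ∈ preserving ρ N :=
  fun Φ hΦ => h₁ _ (h₂ Φ hΦ)

theorem id_mem_preserving : ContinuousMap.id _ ∈ preserving ρ N := fun _ hΦ => hΦ

theorem preserving_subset_closure : preserving ρ N ⊆ closure (realizable ρ N) := by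
  intro Ψ hΨ
  refine hΨ (ContinuousMap.id _) (subset_closure ⟨[], 1, 0, fun z i => ?_⟩)
  simp [dlorForward]

theorem mem_preserving_of_realizable {Ψ : C(Fin N → ℝ, Fin N → ℝ)}
    (h : ∀ Φ ∈ realizable ρ N, Ψ.comp Φ ∈ realizable ρ N) : Ψ ∈ preserving ρ N :=
  fun _ hΦ => map_mem_closure Ψ.continuous_postcomp hΦ h

theorem exists_forward_eq_layer_comp {Φ : C(Fin N → ℝ, Fin N → ℝ)} (hΦ : Φ ∈ realizable ρ N)
    (α : ℝ) (u v b : Fin N → ℝ) :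
    ∃ layers, ∀ z, dlorLayer ρ α u v b (Φ z) = dlorForward ρ layers z := by
  obtain ⟨layers, a, t, h⟩ := hΦ
  refine ⟨layers ++ [(a * α, a • u, v, fun i => α * t i + u i * (v ⬝ᵥ t) + b i)], fun z => ?_⟩
  have hz : Φ z = a • dlorForward ρ layers z + t := by ext i; simp [h]
  ext i
  rw [dlorForward_concat, hz]
  simp only [dlorLayer_apply, dotProduct_add, dotProduct_smul,
    Pi.add_apply, Pi.smul_apply, smul_eq_mul]
  congr 1
  ring

theorem dlorLayer_mem_preserving (α : ℝ) (u v b : Fin N → ℝ) :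
    dlorLayer ρ α u v b ∈ preserving ρ N :=
  mem_preserving_of_realizable fun Φ hΦ => by
    obtain ⟨layers, h⟩ := exists_forward_eq_layer_comp hΦ α u v b
    exact ⟨layers, 1, 0, fun z i => by simp [← h]⟩

theorem homothety_mem_preserving (a : ℝ) (t : Fin N → ℝ) :
    dlorAffine a 0 0 t ∈ preserving ρ N :=
  mem_preserving_of_realizable fun Φ ⟨layers, a', t', h⟩ =>
    ⟨layers, a * a', fun i => a * t' i + t i, fun z i => by simp [h]; ring⟩

theorem mul_dslope_eq (ρ : ℝ → ℝ) (c y : ℝ) {h : ℝ} (hh : h ≠ 0) :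
    y * dslope ρ c (c + h * y) = (ρ (c + h * y) - ρ c) / h := by
  rcases eq_or_ne y 0 with rfl | hy
  · simp
  · have : c + h * y ≠ c := by simp [hh, hy]
    rw [dslope_of_ne _ this, slope_def_field]
    field_simp
    ring

theorem continuous_dslope_of_differentiableAt {ρ : ℝ → ℝ} (hρ : Continuous ρ) {c : ℝ}
    (hc : DifferentiableAt ℝ ρ c) : Continuous (dslope ρ c) := by
  rw [← continuousOn_univ, continuousOn_dslope Filter.univ_mem]
  exact ⟨hρ.continuousOn, hc⟩

variable {c : ℝ} (hc : DifferentiableAt ℝ ρ c) (hd : deriv ρ c ≠ 0)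
include hc hd

theorem dlorAffine_mem_preserving (α : ℝ) (u v b : Fin N → ℝ) :
    dlorAffine α u v b ∈ preserving ρ N := by
  have hs := continuous_dslope_of_differentiableAt ρ.continuous hc
  let F : C(ℝ × (Fin N → ℝ), Fin N → ℝ) :=
    ⟨fun p i => (dlorAffine α u v b p.2 i * dslope ρ c (c + p.1 * dlorAffine α u v b p.2 i))
      / deriv ρ c, by fun_prop⟩
  have hF : dlorAffine α u v b = F.curry 0 := by
    ext z i
    simp [F, dslope_same, hd]
  rw [hF]
  refine ContinuousMap.curry_zero_mem_of_isClosed isClosed_preserving F fun h hh => ?_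
  convert comp_mem_preserving
    (homothety_mem_preserving (1 / (h * deriv ρ c)) fun _ => -ρ c / (h * deriv ρ c))
    (dlorLayer_mem_preserving (ρ := ρ) (h * α) (h • u) v fun i => h * b i + c) using 1
  ext z i
  have : h * α * z i + h * u i * (v ⬝ᵥ z) + (h * b i + c) =
      c + h * dlorAffine α u v b z i := by simp; ring
  simp only [F, ContinuousMap.curry_apply, ContinuousMap.coe_mk, mul_dslope_eq _ _ _ hh,
    ContinuousMap.comp_apply, dlorAffine_apply _ _ _ _ (dlorLayer _ _ _ _ _ _),
    dlorLayer_apply, Pi.smul_apply, smul_eq_mul, this, Pi.zero_apply, zero_mul, add_zero]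
  field_simp
  ring

theorem assign_affineForm_mem_preserving (j : Fin N) (v : Fin N → ℝ) (b : ℝ) :
    assign j (affineForm v b) ∈ preserving ρ N := by
  convert dlorAffine_mem_preserving hc hd 1 (Pi.single j 1) (v - Pi.single j 1)
    (Pi.single j b) using 1
  ext z i
  rcases eq_or_ne i j with rfl | hij
  · simp [sub_dotProduct]
  · simp [hij]

theorem assign_activation_mem_preserving (j : Fin N) (v : Fin N → ℝ) (b : ℝ) :
    assign j (ρ.comp (affineForm v b)) ∈ preserving ρ N := by
  have hs := continuous_dslope_of_differentiableAt ρ.continuous hc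
  let F : C(ℝ × (Fin N → ℝ), Fin N → ℝ) :=
    ⟨fun p => Function.update (fun i => (p.2 i * dslope ρ c (c + p.1 * p.2 i)) / deriv ρ c) j
      (ρ (affineForm v b p.2)),
      Continuous.update (by fun_prop) j (by fun_prop)⟩
  have hF : assign j (ρ.comp (affineForm v b)) = F.curry 0 := by
    ext z i
    simp [F, dslope_same, hd]
  rw [hF]
  refine ContinuousMap.curry_zero_mem_of_isClosed isClosed_preserving F fun h hh => ?_
  convert comp_mem_preserving
    (dlorAffine_mem_preserving hc hd (1 / (h * deriv ρ c)) (Pi.single j 1)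
      (Pi.single j (1 - 1 / (h * deriv ρ c)))
      (Function.update (fun _ => -ρ c / (h * deriv ρ c)) j 0))
    (dlorLayer_mem_preserving (ρ := ρ) h (Pi.single j 1) (v - Pi.single j h)
      (Function.update (fun _ => c) j b)) using 1
  ext z i
  rcases eq_or_ne i j with rfl | hij
  · simp [F, sub_dotProduct]
    ring
  · have := mul_dslope_eq ρ c (z i) hh
    simp only [F, ContinuousMap.curry_apply, ContinuousMap.coe_mk, ne_eq, hij, not_false_eq_true,
      Function.update_of_ne, this]
    simp [hij, add_comm _ c]
    field_simp
    ring

end Machine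

section Squares

open MeasureTheory

variable {M : Submodule ℝ C(ℝ, ℝ)} (hM : IsClosed (M : Set C(ℝ, ℝ)))
include hM

theorem mem_of_eq_intervalIntegral (φ : C(ℝ × ℝ, ℝ)) (hφ : ∀ s, φ.curry s ∈ M) (G : C(ℝ, ℝ))
    (hG : ∀ x, G x = ∫ s in (0 : ℝ)..1, φ (s, x)) : G ∈ M := by
  rw [← SetLike.mem_coe, ← hM.closure_eq, mem_closure_iff_nhds_basis
    (nhds_basis_uniformity' Metric.uniformity_basis_dist.compactConvergenceUniformity)]
  rintro ⟨K, ε⟩ ⟨hK, hε : 0 < ε⟩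
  have := isCompact_iff_compactSpace.1 hK
  let R : C(ℝ, ℝ) → C(K, ℝ) := fun g => g.restrict K
  have hR : IsLinearMap ℝ R := ⟨fun _ _ => rfl, fun _ _ => rfl⟩
  have : IsProbabilityMeasure (volume.restrict (Set.Ioc (0 : ℝ) 1)) := ⟨by simp⟩
  have hcont : Continuous fun s => R (φ.curry s) :=
    (ContinuousMap.continuous_precomp (⟨Subtype.val, continuous_subtype_val⟩ : C(K, ℝ))).comp
      φ.curry.continuous
  have hint : Integrable (fun s => R (φ.curry s)) (volume.restrict (Set.Ioc (0 : ℝ) 1)) :=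
    hcont.integrableOn_Ioc
  have hmem := (M.convex.is_linear_image hR).closure.integral_mem isClosed_closure
    (Filter.Eventually.of_forall fun s => subset_closure ⟨_, hφ s, rfl⟩) hint
  obtain ⟨_, ⟨g, hg, rfl⟩, hlt⟩ := Metric.mem_closure_iff.1 hmem ε hε
  refine ⟨g, hg, fun x hx => ?_⟩
  have hGx : G x = (∫ s in Set.Ioc (0 : ℝ) 1, R (φ.curry s)) ⟨x, hx⟩ := by
    have := (ContinuousMap.evalCLM ℝ (⟨x, hx⟩ : K)).integral_comp_comm hint
    rw [hG, intervalIntegral.integral_of_le zero_le_one]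
    exact this
  rw [Set.mem_ofPred_eq, hGx]
  exact (ContinuousMap.dist_apply_le_dist (⟨x, hx⟩ : K)).trans_lt hlt

/-- Averaging over translations and then differentiating with respect to the dilation
parameter. -/
theorem mul_sub_mem_of_forall_affine (p F : C(ℝ, ℝ))
    (h : ∀ w b : ℝ, p * F.comp ⟨fun x => w * x + b, by fun_prop⟩ ∈ M) (d w b : ℝ) :
    p * .id ℝ * (F.comp ⟨fun x => x + d, by fun_prop⟩ - F).comp
      ⟨fun x => w * x + b, by fun_prop⟩ ∈ M := by
  let U : C(ℝ, ℝ) := ⟨fun y => ∫ s in (0 : ℝ)..y, F s,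
    intervalIntegral.continuous_primitive (fun _ _ => F.continuous.intervalIntegrable _ _) 0⟩
  have hU : ∀ y u, U (y + u) - U y = u * ∫ s in (0 : ℝ)..1, F (y + u * s) := by
    intro y u
    rw [intervalIntegral.mul_integral_comp_add_mul]
    simp only [U, ContinuousMap.coe_mk, mul_zero, add_zero, mul_one]
    exact intervalIntegral.integral_interval_sub_left (F.continuous.intervalIntegrable _ _)
      (F.continuous.intervalIntegrable _ _)
  have hUmem : ∀ w, p * (U.comp ⟨fun x => w * x + b + d, by fun_prop⟩ -
      U.comp ⟨fun x => w * x + b, by fun_prop⟩) ∈ M := by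
    intro w
    refine mem_of_eq_intervalIntegral hM
      ⟨fun q => d * (p q.2 * F (w * q.2 + (b + d * q.1))), by fun_prop⟩
      (fun s => M.smul_mem d (h w (b + d * s))) _ fun x => ?_
    have := hU (w * x + b) d
    simp only [ContinuousMap.coe_mk, ContinuousMap.mul_apply, ContinuousMap.sub_apply,
      ContinuousMap.comp_apply, this, intervalIntegral.integral_const_mul, ← add_assoc]
    ring
  let ψ : C(ℝ × ℝ, ℝ) := ⟨fun q => p q.2 * q.2 * ((∫ s in (0 : ℝ)..1,
    F (w * q.2 + b + d + q.1 * q.2 * s)) - ∫ s in (0 : ℝ)..1, F (w * q.2 + b + q.1 * q.2 * s)),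
    by fun_prop⟩
  have hψ : p * .id ℝ * (F.comp ⟨fun x => x + d, by fun_prop⟩ - F).comp
      ⟨fun x => w * x + b, by fun_prop⟩ = ψ.curry 0 := by
    ext x
    simp [ψ]
  rw [hψ]
  refine ContinuousMap.curry_zero_mem_of_isClosed hM ψ fun t ht => ?_
  rw [SetLike.mem_coe]
  convert M.smul_mem t⁻¹ (M.sub_mem (hUmem (w + t)) (hUmem w)) using 1
  ext x
  have h₁ := hU (w * x + b + d) (t * x)
  have h₂ := hU (w * x + b) (t * x)
  have e₁ : w * x + b + t * x + d = w * x + b + d + t * x := by ring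
  have e₂ : (w + t) * x + b = w * x + b + t * x := by ring
  simp only [ψ, ContinuousMap.curry_apply, ContinuousMap.coe_mk, ContinuousMap.smul_apply,
    ContinuousMap.sub_apply, ContinuousMap.mul_apply, ContinuousMap.comp_apply, smul_eq_mul, e₂,
    e₁, eq_inv_mul_iff_mul_eq₀ ht]
  linear_combination (-p x) * h₁ + p x * h₂

omit hM in
theorem exists_affine_of_second_differences_eq_zero (ρ : C(ℝ, ℝ))
    (h : ∀ b d, ρ (b + d + d) - ρ (b + d) - (ρ (b + d) - ρ b) = 0) :
    ∃ a b : ℝ, ∀ x, ρ x = a * x + b := by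
  have hadd : ∀ x y, ρ (x + y) - ρ 0 = (ρ x - ρ 0) + (ρ y - ρ 0) := by
    intro x y
    have h₁ := h 0 ((x + y) / 2)
    have h₂ := h x ((y - x) / 2)
    have e₁ : 0 + (x + y) / 2 + (x + y) / 2 = x + y := by ring
    have e₂ : x + (y - x) / 2 + (y - x) / 2 = y := by ring
    have e₃ : x + (y - x) / 2 = 0 + (x + y) / 2 := by ring
    rw [e₁] at h₁
    rw [e₂, e₃] at h₂
    linarith
  let g : ℝ →+ ℝ := ⟨⟨fun x => ρ x - ρ 0, by simp⟩, hadd⟩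
  let L := g.toRealLinearMap (by change Continuous fun x => ρ x - ρ 0; fun_prop)
  refine ⟨L 1, ρ 0, fun x => ?_⟩
  have h₁ : L x = x * L 1 := by rw [← smul_eq_mul, ← map_smul, smul_eq_mul, mul_one]
  have h₂ : L x = ρ x - ρ 0 := rfl
  linarith

theorem sq_mem_of_forall_affine {ρ : C(ℝ, ℝ)} (hna : ¬ ∃ a b : ℝ, ∀ x, ρ x = a * x + b)
    (h : ∀ w b : ℝ, ρ.comp ⟨fun x => w * x + b, by fun_prop⟩ ∈ M) :
    (.id ℝ * .id ℝ : C(ℝ, ℝ)) ∈ M := by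
  by_contra hsq
  refine hna (exists_affine_of_second_differences_eq_zero ρ fun b d => ?_)
  by_contra hne
  have h₁ := mul_sub_mem_of_forall_affine hM 1 ρ (by simpa using h) d
  have h₂ := mul_sub_mem_of_forall_affine hM _ _ h₁ d 0 b
  refine hsq ((M.smul_mem_iff hne).1 ?_)
  convert h₂ using 1
  ext x
  simp
  ring

end Squares

section Polynomials

variable {N : ℕ} {ρ : C(ℝ, ℝ)}

/-- The instruction adding `g (v ⬝ᵥ z)` to coordinate `j` and clearing the scratch
coordinate `t`. -/
def accumulate (j t : Fin N) (v : Fin N → ℝ) (g : C(ℝ, ℝ)) : C(Fin N → ℝ, Fin N → ℝ) :=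
  (assign t (affineForm 0 0)).comp
    (assign j (affineForm (Pi.single j 1) 0 + g.comp (affineForm v 0)))

theorem accumulate_apply (j t : Fin N) (v : Fin N → ℝ) (g : C(ℝ, ℝ)) (z : Fin N → ℝ) :
    accumulate j t v g z = Function.update (Function.update z j (z j + g (v ⬝ᵥ z))) t 0 := by
  simp [accumulate]

theorem continuous_accumulate (j t : Fin N) (v : Fin N → ℝ) : Continuous (accumulate j t v) := by
  refine ContinuousMap.continuous_of_continuous_uncurry _ ?_
  simp only [Function.uncurry_def, accumulate_apply]
  refine Continuous.update (Continuous.update (by fun_prop) _ ?_) _ continuous_const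
  have : Continuous fun x : C(ℝ, ℝ) × (Fin N → ℝ) => v ⬝ᵥ x.2 := by unfold dotProduct; fun_prop
  fun_prop

theorem dotProduct_update_of_eq_zero {v : Fin N → ℝ} {j : Fin N} (hv : v j = 0) (z : Fin N → ℝ)
    (a : ℝ) : v ⬝ᵥ Function.update z j a = v ⬝ᵥ z := by
  refine Finset.sum_congr rfl fun i _ => ?_
  rcases eq_or_ne i j with rfl | h <;> simp [*]

variable {c : ℝ} (hc : DifferentiableAt ℝ ρ c) (hd : deriv ρ c ≠ 0)
  (hna : ¬ ∃ a b : ℝ, ∀ x, ρ x = a * x + b)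
include hc hd hna

theorem accumulate_sq_mem_preserving {j t : Fin N} (hjt : j ≠ t) {v : Fin N → ℝ} (hj : v j = 0)
    (ht : v t = 0) (a : ℝ) : accumulate j t v (a • (.id ℝ * .id ℝ)) ∈ preserving ρ N := by
  have hcomp : ∀ g g', accumulate j t v (g + g') =
      (accumulate j t v g).comp (accumulate j t v g') := by
    intro g g'
    ext z i
    simp only [ContinuousMap.comp_apply, accumulate_apply, dotProduct_update_of_eq_zero hj,
      dotProduct_update_of_eq_zero ht]
    rcases eq_or_ne i t with rfl | hit
    · simp
    · rcases eq_or_ne i j with rfl | hij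
      · simp [hit]; ring
      · simp [hit, hij]
  let M : Submodule ℝ C(ℝ, ℝ) :=
    { carrier := {g | ∀ a : ℝ, accumulate j t v (a • g) ∈ preserving ρ N}
      add_mem' := fun {g g'} hg hg' a => by
        rw [smul_add, hcomp]
        exact comp_mem_preserving (hg a) (hg' a)
      zero_mem' := fun a => by
        convert assign_affineForm_mem_preserving (N := N) hc hd t 0 0 using 1
        ext z
        simp [accumulate_apply]
      smul_mem' := fun r g hg a => by rw [smul_smul]; exact hg _ }
  have hM : IsClosed (M : Set C(ℝ, ℝ)) := by
    have : (M : Set C(ℝ, ℝ)) =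
        ⋂ a : ℝ, (fun g => accumulate j t v (a • g)) ⁻¹' preserving ρ N := by
      ext g; simp [M]
    rw [this]
    exact isClosed_iInter fun a => isClosed_preserving.preimage
      ((continuous_accumulate j t v).comp (continuous_const_smul a))
  refine sq_mem_of_forall_affine hM hna (fun w b a => ?_) a
  convert comp_mem_preserving (assign_affineForm_mem_preserving hc hd t 0 0)
    (comp_mem_preserving
      (assign_affineForm_mem_preserving hc hd j (Pi.single j 1 + Pi.single t a) 0)
      (assign_activation_mem_preserving hc hd t (w • v) b)) using 1
  ext z i
  rcases eq_or_ne i t with rfl | hit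
  · simp [accumulate_apply]
  · rcases eq_or_ne i j with rfl | hij
    · simp [accumulate_apply, hit, add_dotProduct, mul_comm]
    · simp [accumulate_apply, hit, hij]

theorem exists_mul_mem_preserving {p q t i : Fin N} (hpq : p ≠ q) (hpt : p ≠ t) (hqt : q ≠ t)
    (hi : i ≠ p ∧ i ≠ q ∧ i ≠ t) :
    ∃ Ψ ∈ preserving ρ N, ∀ z, Ψ z p = z p * z i ∧
      ∀ j, j ≠ p ∧ j ≠ q ∧ j ≠ t → Ψ z j = z j := by
  obtain ⟨hip, hiq, hit⟩ := hi
  refine ⟨_, comp_mem_preserving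
    (assign_affineForm_mem_preserving hc hd p (Pi.single q 1) 0)
    (comp_mem_preserving
      (accumulate_sq_mem_preserving hc hd hna (j := q) (t := t)
        (v := Pi.single p 1 - Pi.single i 1) hqt (by simp [*, hpq.symm, hiq.symm])
        (by simp [*, hpt.symm, hit.symm]) (-1 / 4))
      (comp_mem_preserving
        (accumulate_sq_mem_preserving hc hd hna (j := q) (t := t)
          (v := Pi.single p 1 + Pi.single i 1) hqt (by simp [*, hpq.symm, hiq.symm])
          (by simp [*, hpt.symm, hit.symm]) (1 / 4))
        (assign_affineForm_mem_preserving hc hd q 0 0))), fun z => ⟨?_, ?_⟩⟩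
  · simp [accumulate_apply, add_dotProduct, sub_dotProduct, *]
    ring
  · rintro j ⟨hjp, hjq, hjt⟩
    simp [accumulate_apply, *]

variable {σ : Type*}

theorem exists_monomial_mem_preserving {p q t : Fin N} (hpq : p ≠ q) (hpt : p ≠ t) (hqt : q ≠ t)
    {e : σ → Fin N} (he : ∀ i, e i ≠ p ∧ e i ≠ q ∧ e i ≠ t) (s : σ →₀ ℕ) (a : ℝ) :
    ∃ Ψ ∈ preserving ρ N, ∀ z,
      Ψ z p = MvPolynomial.eval (fun i => z (e i)) (MvPolynomial.monomial s a) ∧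
      ∀ j, j ≠ p ∧ j ≠ q ∧ j ≠ t → Ψ z j = z j := by
  refine MvPolynomial.induction_on_monomial (motive := fun P => ∃ Ψ ∈ preserving ρ N, ∀ z,
    Ψ z p = MvPolynomial.eval (fun i => z (e i)) P ∧
      ∀ j, j ≠ p ∧ j ≠ q ∧ j ≠ t → Ψ z j = z j) (fun a => ?_) (fun P i ih => ?_) s a
  · refine ⟨_, assign_affineForm_mem_preserving hc hd p 0 a, fun z => ⟨by simp, ?_⟩⟩
    rintro j ⟨hj, -⟩
    simp [hj]
  · obtain ⟨Ψ, hΨ, h⟩ := ih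
    obtain ⟨Θ, hΘ, h'⟩ := exists_mul_mem_preserving hc hd hna hpq hpt hqt (he i)
    refine ⟨_, comp_mem_preserving hΘ hΨ, fun z => ⟨?_, fun j hj => ?_⟩⟩
    · simp [(h' _).1, (h z).1, (h z).2 _ (he i)]
    · simp [(h' _).2 _ hj, (h z).2 _ hj]

theorem exists_add_polynomial_mem_preserving {p q t k : Fin N} (hpq : p ≠ q) (hpt : p ≠ t)
    (hqt : q ≠ t) (hk : k ≠ p ∧ k ≠ q ∧ k ≠ t) {e : σ → Fin N}
    (he : ∀ i, e i ≠ p ∧ e i ≠ q ∧ e i ≠ t) (hek : ∀ i, e i ≠ k) (P : MvPolynomial σ ℝ) :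
    ∃ Ψ ∈ preserving ρ N, ∀ z, Ψ z k = z k + MvPolynomial.eval (fun i => z (e i)) P ∧
      ∀ j, j ≠ p ∧ j ≠ q ∧ j ≠ t → j ≠ k → Ψ z j = z j := by
  induction P using MvPolynomial.induction_on' with
  | monomial s a =>
    obtain ⟨Ψ, hΨ, h⟩ := exists_monomial_mem_preserving hc hd hna hpq hpt hqt he s a
    refine ⟨_, comp_mem_preserving
      (assign_affineForm_mem_preserving hc hd k (Pi.single k 1 + Pi.single p 1) 0) hΨ,
      fun z => ⟨?_, fun j hj hjk => ?_⟩⟩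
    · simp [add_dotProduct, (h z).1, (h z).2 k hk]
    · simp [hjk, (h z).2 j hj]
  | add P Q ihP ihQ =>
    obtain ⟨Ψ, hΨ, h⟩ := ihP
    obtain ⟨Θ, hΘ, h'⟩ := ihQ
    refine ⟨_, comp_mem_preserving hΘ hΨ, fun z => ⟨?_, fun j hj hjk => ?_⟩⟩
    · have : ∀ i, Ψ z (e i) = z (e i) := fun i => (h z).2 _ (he i) (hek i)
      simp [(h' _).1, (h z).1, this, add_assoc]
    · simp [(h' _).2 j hj hjk, (h z).2 j hj hjk]

theorem exists_add_polynomials_mem_preserving {κ : Type*} [Fintype κ] {p q t : Fin N}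
    (hpq : p ≠ q) (hpt : p ≠ t) (hqt : q ≠ t) {k : κ → Fin N} (hkinj : Function.Injective k)
    (hk : ∀ l, k l ≠ p ∧ k l ≠ q ∧ k l ≠ t) {e : σ → Fin N}
    (he : ∀ i, e i ≠ p ∧ e i ≠ q ∧ e i ≠ t) (hek : ∀ i l, e i ≠ k l)
    (P : κ → MvPolynomial σ ℝ) :
    ∃ Ψ ∈ preserving ρ N, ∀ z l,
      Ψ z (k l) = z (k l) + MvPolynomial.eval (fun i => z (e i)) (P l) := by
  classical
  suffices h : ∀ s : Finset κ, ∃ Ψ ∈ preserving ρ N, ∀ z, (∀ i, Ψ z (e i) = z (e i)) ∧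
      ∀ l, Ψ z (k l) =
        z (k l) + if l ∈ s then MvPolynomial.eval (fun i => z (e i)) (P l) else 0 by
    obtain ⟨Ψ, hΨ, h⟩ := h Finset.univ
    exact ⟨Ψ, hΨ, fun z l => by simpa using (h z).2 l⟩
  intro s
  induction s using Finset.induction_on with
  | empty => exact ⟨_, id_mem_preserving, fun z => by simp⟩
  | insert l s hl ih =>
    obtain ⟨Ψ, hΨ, h⟩ := ih
    obtain ⟨Θ, hΘ, h'⟩ := exists_add_polynomial_mem_preserving hc hd hna hpq hpt hqt (hk l) he
      (fun i => hek i l) (P l)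
    refine ⟨_, comp_mem_preserving hΘ hΨ, fun z => ⟨fun i => ?_, fun l' => ?_⟩⟩
    · simp [(h' _).2 _ (he i) (hek i l), (h z).1]
    · rcases eq_or_ne l' l with rfl | hne
      · simp [(h' _).1, (h z).1, (h z).2, hl]
      · simp [(h' _).2 _ (hk l') (hkinj.ne hne), (h z).2, hne]

end Polynomials

section Readout

variable {N m : ℕ} {ρ : C(ℝ, ℝ)}

/-- Networks with a linear readout. -/
def readouts (ρ : C(ℝ, ℝ)) (N m : ℕ) : Set C(Fin N → ℝ, Fin m → ℝ) :=
  {Γ | ∃ layers, ∃ C : Matrix (Fin m) (Fin N) ℝ,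
    ∀ z, Γ z = C.mulVec (dlorForward ρ layers z)}

/-- The homothety following a network is absorbed into a linear readout by means of a
coordinate `q` holding a nonzero constant. -/
theorem proj_comp_mem_closure_readouts {c : ℝ} (hc : DifferentiableAt ℝ ρ c)
    (hd : deriv ρ c ≠ 0) {b₀ : ℝ} (hb₀ : ρ b₀ ≠ 0) {k : Fin m → Fin N} {q : Fin N}
    (hk : ∀ l, k l ≠ q) {Ψ : C(Fin N → ℝ, Fin N → ℝ)} (hΨ : Ψ ∈ closure (realizable ρ N)) :
    (⟨fun z l => z (k l), by fun_prop⟩ : C(Fin N → ℝ, Fin m → ℝ)).comp Ψ ∈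
      closure (readouts ρ N m) := by
  rw [← closure_closure (s := readouts ρ N m)]
  refine map_mem_closure (ContinuousMap.continuous_postcomp _) hΨ fun Φ hΦ => ?_
  have hs := continuous_dslope_of_differentiableAt ρ.continuous hc
  let F : C(ℝ × (Fin N → ℝ), Fin m → ℝ) :=
    ⟨fun p l => (Φ p.2 (k l) * dslope ρ c (c + p.1 * Φ p.2 (k l))) / deriv ρ c, by fun_prop⟩
  have hF : (⟨fun z l => z (k l), by fun_prop⟩ : C(Fin N → ℝ, Fin m → ℝ)).comp Φ =
      F.curry 0 := by
    ext z l
    simp [F, dslope_same, hd]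
  rw [hF]
  refine ContinuousMap.curry_zero_mem_of_isClosed isClosed_closure F fun h hh =>
    subset_closure ?_
  obtain ⟨layers, hl⟩ := exists_forward_eq_layer_comp hΦ h (Pi.single q 1) (-Pi.single q h)
    (Function.update (fun _ => c) q b₀)
  refine ⟨layers, Matrix.of fun l =>
    (h * deriv ρ c)⁻¹ • (Pi.single (k l) 1 - Pi.single q (ρ c / ρ b₀)), fun z => ?_⟩
  ext l
  have hrow : ∀ w : Fin N → ℝ, (Matrix.of fun l =>
      (h * deriv ρ c)⁻¹ • (Pi.single (k l) 1 - Pi.single q (ρ c / ρ b₀))).mulVec w l =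
      (h * deriv ρ c)⁻¹ * (w (k l) - ρ c / ρ b₀ * w q) := by
    intro w
    have : ∀ v : Fin N → ℝ, (Matrix.of fun _ : Fin m => v).mulVec w l = v ⬝ᵥ w := fun _ => rfl
    refine (this _).trans ?_
    rw [smul_dotProduct, sub_dotProduct, single_dotProduct, single_dotProduct, one_mul,
      smul_eq_mul]
  rw [← hl, hrow]
  have := mul_dslope_eq ρ c (Φ z (k l)) hh
  simp only [F, ContinuousMap.curry_apply, ContinuousMap.coe_mk, this]
  simp [hk, hb₀, add_comm _ c]
  field_simp

end Readout

theorem continuous_padInput (n N : ℕ) : Continuous (padInput n N) := by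
  refine continuous_pi fun j => ?_
  unfold padInput
  split_ifs <;> fun_prop

theorem exists_mvPolynomial_near {n : ℕ} {K : Set (Fin n → ℝ)} (hK : IsCompact K)
    {f : (Fin n → ℝ) → ℝ} (hf : ContinuousOn f K) {ε : ℝ} (hε : 0 < ε) :
    ∃ P : MvPolynomial (Fin n) ℝ, ∀ x ∈ K, |MvPolynomial.eval x P - f x| < ε := by
  have := isCompact_iff_compactSpace.1 hK
  let X : Fin n → C(K, ℝ) := fun i =>
    ⟨fun x => x.1 i, (continuous_apply i).comp continuous_subtype_val⟩
  have hsep : (MvPolynomial.aeval (R := ℝ) X).range.SeparatesPoints := by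
    intro x y hxy
    obtain ⟨i, hi⟩ := Function.ne_iff.1 (Subtype.coe_ne_coe.2 hxy)
    exact ⟨X i, ⟨X i, ⟨MvPolynomial.X i, MvPolynomial.aeval_X _ _⟩, rfl⟩, hi⟩
  have heval : ∀ P x, MvPolynomial.aeval X P x = MvPolynomial.eval x.1 P := by
    intro P x
    induction P using MvPolynomial.induction_on <;> simp_all [X]
  let g : C(K, ℝ) := ⟨K.domRestrict f, hf.domRestrict⟩
  obtain ⟨⟨_, P, rfl⟩, hP⟩ :=
    ContinuousMap.exists_mem_subalgebra_near_continuousMap_of_separatesPoints _ hsep g ε hε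
  refine ⟨P, fun x hx => ?_⟩
  rw [← heval P ⟨x, hx⟩]
  exact (ContinuousMap.norm_coe_le_norm (MvPolynomial.aeval X P - g) ⟨x, hx⟩).trans_lt hP

/-- Universal approximation via the augmented state space, width
`2(n + m + 2)`: for any non-affine continuous `ρ` differentiable at some `c` with
`ρ'(c) ≠ 0`, any compact `K ⊆ ℝ^n`, continuous `f : K → ℝ^m`, and `ε > 0`, there is
a deep DLoR network of width `2(n + m + 2)`, with every hidden weight matrix of the
form `α I + u vᵀ`, zero-padded input and linear readout, approximating `f`
uniformly on `K` within `ε`. -/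
theorem stmt15 (ρ : ℝ → ℝ) (hρc : Continuous ρ)
    (hna : ¬ ∃ a b : ℝ, ∀ x, ρ x = a * x + b)
    (c : ℝ) (hdiff : DifferentiableAt ℝ ρ c) (hd : deriv ρ c ≠ 0)
    (n m : ℕ) (K : Set (Fin n → ℝ)) (hK : IsCompact K)
    (f : (Fin n → ℝ) → Fin m → ℝ) (hf : ContinuousOn f K)
    (ε : ℝ) (hε : 0 < ε) :
    ∃ layers : List (ℝ × (Fin (2 * (n + m + 2)) → ℝ) × (Fin (2 * (n + m + 2)) → ℝ) ×
        (Fin (2 * (n + m + 2)) → ℝ)),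
      ∃ C : Matrix (Fin m) (Fin (2 * (n + m + 2))) ℝ,
        ∀ x ∈ K,
          ‖C.mulVec (dlorForward ρ layers (padInput n (2 * (n + m + 2)) x)) - f x‖ < ε := by
  let N := 2 * (n + m + 2)
  let σ : C(ℝ, ℝ) := ⟨ρ, hρc⟩
  obtain ⟨b₀, hb₀⟩ : ∃ b₀, σ b₀ ≠ 0 := by
    by_contra! h
    exact hna ⟨0, 0, fun x => by simpa [σ] using h x⟩
  choose P hP using fun l : Fin m =>
    exists_mvPolynomial_near hK (continuousOn_pi.1 hf l) (half_pos hε)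
  let e : Fin n → Fin N := fun i => ⟨i, by omega⟩
  let k : Fin m → Fin N := fun l => ⟨n + l, by omega⟩
  let r : Fin 3 → Fin N := fun i => ⟨n + m + i, by omega⟩
  have hr : Function.Injective r := fun i j h => by
    simp only [r, Fin.mk.injEq] at h
    omega
  have hkr : ∀ l i, k l ≠ r i := fun l i h => by
    simp only [k, r, Fin.mk.injEq] at h
    omega
  have her : ∀ l i, e l ≠ r i := fun l i h => by
    simp only [e, r, Fin.mk.injEq] at h
    omega
  obtain ⟨Ψ, hΨ, h⟩ := exists_add_polynomials_mem_preserving (ρ := σ) hdiff hd hna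
    (p := r 0) (q := r 1) (t := r 2) (hr.ne (by decide)) (hr.ne (by decide))
    (hr.ne (by decide)) (k := k) (fun i j h => by simpa [k, Fin.ext_iff] using h)
    (fun l => ⟨hkr l 0, hkr l 1, hkr l 2⟩) (e := e) (fun l => ⟨her l 0, her l 1, her l 2⟩)
    (fun i l h => by simp only [e, k, Fin.mk.injEq] at h; omega) P
  have hT := proj_comp_mem_closure_readouts hdiff hd hb₀ (fun l => hkr l 0)
    (preserving_subset_closure hΨ)
  rw [mem_closure_iff_nhds_basis
    (nhds_basis_uniformity' Metric.uniformity_basis_dist.compactConvergenceUniformity)] at hT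
  obtain ⟨Γ, ⟨layers, C, hΓ⟩, hlt⟩ :=
    hT (padInput n N '' K, ε / 2) ⟨hK.image (continuous_padInput n N), half_pos hε⟩
  refine ⟨layers, C, fun x hx => ?_⟩
  have h₁ := hlt _ (Set.mem_image_of_mem _ hx)
  have h₂ : dist (fun l => Ψ (padInput n N x) (k l)) (f x) < ε / 2 := by
    refine (dist_pi_lt_iff (half_pos hε)).2 fun l => ?_
    have hx₁ : padInput n N x (k l) = 0 := by simp [padInput, k]
    have hx₂ : (fun i => padInput n N x (e i)) = x := by ext i; simp [padInput, e]
    rw [h, hx₁, hx₂, zero_add, Real.dist_eq]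
    exact hP l x hx
  rw [← dist_eq_norm]
  have h₃ : dist (C.mulVec (dlorForward ρ layers (padInput n N x)))
      (fun l => Ψ (padInput n N x) (k l)) < ε / 2 := by
    rw [dist_comm]
    have hx' : Γ (padInput n N x) = C.mulVec (dlorForward ρ layers (padInput n N x)) := hΓ _
    rw [← hx']
    exact h₁
  linarith [dist_triangle (C.mulVec (dlorForward ρ layers (padInput n N x)))
    (fun l => Ψ (padInput n N x) (k l)) (f x)]
end
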